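/- arXiv:2310.19861 — 2 statements merged into one kernel-verified Lean document; each statement's English description precedes it below -/
import Mathlib

section
/- Let d, T ≥ 1, let φ₁, …, φ_T ∈ ℝ^d satisfy ‖φ_t‖₂ ≤ 1 for all t, let Λ₀ be a positive definite real d×d matrix, and define Λ_t = Λ₀ + Σ_{ι=1}^{t} φ_ι φ_ι^⊤ for 1 ≤ t ≤ T. Then Σ_{t=1}^{T} min{ φ_t^⊤ Λ_{t−1}^{−1} φ_t , 1 } ≤ 2·log( det Λ_T / det Λ₀ ). -/
open Finset Real Matrix

/-- The matrix determinant lemma for a symmetric rank-one update. -/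
lemma Matrix.det_add_vecMulVec_self {n R : Type*} [Fintype n] [DecidableEq n] [CommRing R]
    {A : Matrix n n R} (hA : IsUnit A.det) (v : n → R) :
    (A + vecMulVec v v).det = A.det * (1 + v ⬝ᵥ A⁻¹ *ᵥ v) := by
  rw [vecMulVec_eq Unit, det_add_replicateCol_mul_replicateRow hA, det_unique (n := Unit),
    add_apply, one_apply_eq, Matrix.mul_assoc, ← replicateCol_mulVec,
    replicateRow_mul_replicateCol_apply]

lemma Matrix.PosDef.add_sum_vecMulVec_self {n ι : Type*} [Fintype n] {A : Matrix n n ℝ}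
    (hA : A.PosDef) (s : Finset ι) (φ : ι → n → ℝ) :
    (A + ∑ i ∈ s, vecMulVec (φ i) (φ i)).PosDef :=
  hA.add_posSemidef <| posSemidef_sum s fun i _ => by
    simpa using posSemidef_vecMulVec_self_star (φ i)

lemma Real.min_one_le_two_mul_log_one_add {x : ℝ} (hx : 0 ≤ x) :
    min x 1 ≤ 2 * log (1 + x) := by
  have hm : 0 ≤ min x 1 := le_min hx zero_le_one
  have hm1 : min x 1 ≤ 1 := min_le_right x 1
  have hlog : log (1 + min x 1) ≤ log (1 + x) :=
    log_le_log (by linarith) (by linarith [min_le_left x 1])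
  have hinv : 1 - (1 + min x 1)⁻¹ ≤ log (1 + min x 1) :=
    one_sub_inv_le_log_of_pos (by linarith)
  have hhalf : (1 + min x 1)⁻¹ ≤ 1 - min x 1 / 2 := by
    rw [inv_le_iff_one_le_mul₀ (by linarith)]
    nlinarith
  linarith

/-- Elliptical potential lemma: for vectors `φ₁, …, φ_T` of Euclidean norm at most 1
and a positive definite `Λ₀`, with `Λ_t = Λ₀ + ∑_{ι=1}^t φ_ι φ_ι^⊤`,
`∑_{t=1}^T min (φ_t^⊤ Λ_{t−1}⁻¹ φ_t) 1 ≤ 2 log (det Λ_T / det Λ₀)`. -/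
theorem elliptical_potential_lemma
    {d : ℕ} (hd : 1 ≤ d) (T : ℕ) (hT : 1 ≤ T)
    (φ : ℕ → Fin d → ℝ)
    (hφ : ∀ t ∈ Finset.Icc 1 T, Real.sqrt (∑ i, (φ t i) ^ 2) ≤ 1)
    (Λ₀ : Matrix (Fin d) (Fin d) ℝ) (hΛ₀ : Λ₀.PosDef)
    (Λ : ℕ → Matrix (Fin d) (Fin d) ℝ)
    (hΛ : ∀ t, Λ t = Λ₀ + ∑ ι ∈ Finset.Icc 1 t, Matrix.vecMulVec (φ ι) (φ ι)) :
    ∑ t ∈ Finset.Icc 1 T,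
        min (dotProduct (φ t) ((Λ (t - 1))⁻¹.mulVec (φ t))) 1
      ≤ 2 * Real.log ((Λ T).det / Λ₀.det) := by
  have hpos (t : ℕ) : (Λ t).PosDef := hΛ t ▸ hΛ₀.add_sum_vecMulVec_self _ φ
  have hstep (t : ℕ) : Λ (t + 1) = Λ t + vecMulVec (φ (t + 1)) (φ (t + 1)) := by
    rw [hΛ, hΛ, Finset.sum_Icc_succ_top (by omega), add_assoc]
  clear hT hφ
  induction T with
  | zero => simp [hΛ, hΛ₀.det_pos.ne']
  | succ t ih =>
    rw [Finset.sum_Icc_succ_top (by omega), Nat.add_sub_cancel]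
    have hx : 0 ≤ φ (t + 1) ⬝ᵥ (Λ t)⁻¹ *ᵥ φ (t + 1) := by
      simpa using (hpos t).inv.posSemidef.dotProduct_mulVec_nonneg (φ (t + 1))
    have hlog : log ((Λ (t + 1)).det / Λ₀.det) =
        log ((Λ t).det / Λ₀.det) + log (1 + φ (t + 1) ⬝ᵥ (Λ t)⁻¹ *ᵥ φ (t + 1)) := by
      rw [hstep, det_add_vecMulVec_self (hpos t).det_pos.ne'.isUnit, mul_div_right_comm,
        log_mul (div_pos (hpos t).det_pos hΛ₀.det_pos).ne' (by positivity)]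
    rw [hlog, mul_add]
    exact add_le_add ih (min_one_le_two_mul_log_one_add hx)
end

section
/- Let d, T ≥ 1, λ > 0, let φ₁, …, φ_T ∈ ℝ^d satisfy ‖φ_t‖₂ ≤ 1 for all t, and define Λ_t = λ·I_d + Σ_{ι=1}^{t} φ_ι φ_ι^⊤ for 0 ≤ t ≤ T. Then the number of indices t ∈ {1, …, T} for which φ_t^⊤ Λ_{t−1}^{−1} φ_t ≥ 1 is at most (3d / log 2)·log(1 + 1/(λ·log 2)). -/
open Finset Real Matrix

namespace Matrix

theorem posSemidef_vecMulVec_self {n : Type*} [Finite n] (v : n → ℝ) :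
    (vecMulVec v v).PosSemidef := by
  simpa using posSemidef_vecMulVec_self_star v

/-- The Gram matrix `lam • 1 + ∑ i ∈ s, φ i (φ i)ᵀ`. -/
def regularizedGram {n ι : Type*} [DecidableEq n] (lam : ℝ) (φ : ι → n → ℝ)
    (s : Finset ι) : Matrix n n ℝ :=
  lam • 1 + ∑ i ∈ s, vecMulVec (φ i) (φ i)

theorem regularizedGram_insert {n ι : Type*} [DecidableEq n] [DecidableEq ι] {lam : ℝ}
    {φ : ι → n → ℝ} {s : Finset ι} {i : ι} (hi : i ∉ s) :
    regularizedGram lam φ (insert i s) = regularizedGram lam φ s + vecMulVec (φ i) (φ i) := by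
  rw [regularizedGram, regularizedGram, sum_insert hi]
  abel

variable {n : Type*} [Fintype n] [DecidableEq n]

/-- Inversion reverses the Loewner order, stated on quadratic forms. -/
theorem PosDef.dotProduct_inv_mulVec_le {A B : Matrix n n ℝ} (hA : A.PosDef)
    (hAB : (B - A).PosSemidef) (v : n → ℝ) :
    v ⬝ᵥ (B⁻¹ *ᵥ v) ≤ v ⬝ᵥ (A⁻¹ *ᵥ v) := by
  have hB : B.PosDef := by simpa using hA.add_posSemidef hAB
  set x := B⁻¹ *ᵥ v with hx
  set y := A⁻¹ *ᵥ v with hy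
  have hAy : A *ᵥ y = v := by
    rw [hy, mulVec_mulVec, mul_nonsing_inv _ (A.isUnit_iff_isUnit_det.mp hA.isUnit), one_mulVec]
  have hBx : B *ᵥ x = v := by
    rw [hx, mulVec_mulVec, mul_nonsing_inv _ (B.isUnit_iff_isUnit_det.mp hB.isUnit), one_mulVec]
  have hyAx : y ⬝ᵥ (A *ᵥ x) = v ⬝ᵥ x := by
    have hAt : Aᵀ = A := by simpa using hA.isHermitian.eq
    rw [dotProduct_mulVec, ← mulVec_transpose, hAt, hAy]
  have hxy := hA.posSemidef.dotProduct_mulVec_nonneg (x - y)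
  have hxx := hAB.dotProduct_mulVec_nonneg x
  simp only [star_trivial, mulVec_sub, sub_mulVec, dotProduct_sub, sub_dotProduct, hAy, hBx,
    hyAx, dotProduct_comm x v, dotProduct_comm y v] at hxy hxx
  linarith

/-- The **matrix determinant lemma** for a symmetric rank-one update. -/
theorem det_add_vecMulVec_self_s4 {A : Matrix n n ℝ} (hA : IsUnit A.det) (v : n → ℝ) :
    (A + vecMulVec v v).det = A.det * (1 + v ⬝ᵥ (A⁻¹ *ᵥ v)) := by
  rw [vecMulVec_eq Unit, det_add_replicateCol_mul_replicateRow hA, det_unique (n := Unit),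
    Matrix.mul_assoc, ← replicateCol_mulVec, add_apply, one_apply_eq,
    replicateRow_mul_replicateCol_apply]

/-- The arithmetic-geometric mean inequality for the eigenvalues of a matrix. -/
theorem PosDef.log_det_le [Nonempty n] {A : Matrix n n ℝ} (hA : A.PosDef) :
    log A.det ≤ Fintype.card n * log (A.trace / Fintype.card n) := by
  have hcard : (0 : ℝ) < Fintype.card n := by exact_mod_cast Fintype.card_pos
  have hc : 0 < A.trace / Fintype.card n := div_pos hA.trace_pos hcard
  set c := A.trace / Fintype.card n with hc_def
  have htrace : ∑ i, hA.isHermitian.eigenvalues i = Fintype.card n * c := by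
    rw [hc_def, mul_div_cancel₀ _ hcard.ne', hA.isHermitian.trace_eq_sum_eigenvalues]
    simp
  have hlog (i : n) : log (hA.isHermitian.eigenvalues i) ≤
      hA.isHermitian.eigenvalues i / c - 1 + log c := by
    have h := log_le_sub_one_of_pos (div_pos (hA.eigenvalues_pos i) hc)
    rw [log_div (hA.eigenvalues_pos i).ne' hc.ne'] at h
    linarith
  calc log A.det = ∑ i, log (hA.isHermitian.eigenvalues i) := by
        rw [hA.isHermitian.det_eq_prod_eigenvalues]
        simp only [RCLike.ofReal_real_eq_id, id_eq]
        exact log_prod fun i _ => (hA.eigenvalues_pos i).ne'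
    _ ≤ ∑ i, (hA.isHermitian.eigenvalues i / c - 1 + log c) := sum_le_sum fun i _ => hlog i
    _ = Fintype.card n * log c := by
        rw [sum_add_distrib, sum_sub_distrib, ← sum_div, htrace]
        simp [mul_div_cancel_right₀ _ hc.ne']

section RegularizedGram

variable {ι : Type*} {lam : ℝ} {φ : ι → n → ℝ} {s t : Finset ι}

theorem posDef_regularizedGram (hlam : 0 < lam) : (regularizedGram lam φ s).PosDef :=
  (PosDef.one.smul hlam).add_posSemidef
    (posSemidef_sum s fun i _ => posSemidef_vecMulVec_self (φ i))

theorem posSemidef_regularizedGram_sub [DecidableEq ι] (hst : s ⊆ t) :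
    (regularizedGram lam φ t - regularizedGram lam φ s).PosSemidef := by
  have h : regularizedGram lam φ t - regularizedGram lam φ s =
      ∑ i ∈ t \ s, vecMulVec (φ i) (φ i) := by
    rw [regularizedGram, regularizedGram, ← sum_sdiff hst]
    abel
  rw [h]
  exact posSemidef_sum _ fun i _ => posSemidef_vecMulVec_self (φ i)

theorem trace_regularizedGram_le (hφ : ∀ i ∈ s, φ i ⬝ᵥ φ i ≤ 1) :
    (regularizedGram lam φ s).trace ≤ lam * Fintype.card n + #s := by
  simp only [regularizedGram, trace_add, trace_smul, trace_one, trace_sum, trace_vecMulVec,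
    smul_eq_mul]
  have h := sum_le_card_nsmul s _ 1 hφ
  simp only [nsmul_eq_mul, mul_one] at h
  linarith

/-- Each index with large elliptical potential doubles the determinant of the Gram matrix
restricted to such indices. -/
theorem pow_mul_two_pow_le_det_regularizedGram {φ : ℕ → n → ℝ} (hlam : 0 < lam) (p : ℕ → Prop)
    [DecidablePred p]
    (hp : ∀ k, p k → 1 ≤ φ k ⬝ᵥ ((regularizedGram lam φ (Icc 1 (k - 1)))⁻¹ *ᵥ φ k)) (T : ℕ) :
    lam ^ Fintype.card n * 2 ^ #{k ∈ Icc 1 T | p k} ≤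
      (regularizedGram lam φ {k ∈ Icc 1 T | p k}).det := by
  induction T with
  | zero => simp [regularizedGram]
  | succ T ih =>
    rw [← insert_Icc_right_eq_Icc_add_one (by omega), filter_insert]
    split_ifs with h
    · have hmem : T + 1 ∉ ({k ∈ Icc 1 T | p k} : Finset ℕ) := by simp
      have hpd := posDef_regularizedGram (φ := φ) (s := {k ∈ Icc 1 T | p k}) hlam
      have hpot := (hp _ h).trans (hpd.dotProduct_inv_mulVec_le
        (posSemidef_regularizedGram_sub (filter_subset _ _)) (φ (T + 1)))
      rw [regularizedGram_insert hmem, card_insert_of_notMem hmem, pow_succ, ← mul_assoc,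
        det_add_vecMulVec_self_s4 hpd.det_pos.ne'.isUnit]
      exact mul_le_mul ih (by linarith) zero_le_two hpd.det_pos.le
    · exact ih

end RegularizedGram

end Matrix

theorem le_three_mul_log_of_le_log {a y : ℝ} (ha : 0 < a) (hy : 0 ≤ y)
    (h : y ≤ log (1 + a * y)) : y ≤ 3 * log (1 + a) := by
  rcases hy.eq_or_lt with rfl | hy
  · exact mul_nonneg zero_le_three (log_nonneg (by linarith))
  have hexp : exp y ≤ 1 + a * y := (le_log_iff_exp_le (by positivity)).mp h
  have hquad : 1 + y / 2 ≤ a := by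
    nlinarith [quadratic_le_exp_of_nonneg hy.le]
  calc y ≤ log (1 + a * y) := h
    _ ≤ log ((1 + a) ^ 3) := log_le_log (by positivity) (by nlinarith [pow_pos ha 3])
    _ = 3 * log (1 + a) := by rw [log_pow]; norm_num

/-- Estimation of the elliptical potential: with `Λ_t = λ I + ∑_{ι=1}^t φ_ι φ_ι^⊤` and
`‖φ_t‖₂ ≤ 1`, the number of indices `t ∈ {1,…,T}` with `φ_t^⊤ Λ_{t−1}⁻¹ φ_t ≥ 1` is at most
`(3 d / log 2) · log (1 + 1 / (λ log 2))`. -/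
theorem estimation_of_elliptical_potential
    {d : ℕ} (hd : 1 ≤ d) (T : ℕ) (hT : 1 ≤ T) (lam : ℝ) (hlam : 0 < lam)
    (φ : ℕ → Fin d → ℝ)
    (hφ : ∀ t ∈ Finset.Icc 1 T, Real.sqrt (∑ i, (φ t i) ^ 2) ≤ 1)
    (Λ : ℕ → Matrix (Fin d) (Fin d) ℝ)
    (hΛ : ∀ t, Λ t = lam • (1 : Matrix (Fin d) (Fin d) ℝ)
        + ∑ ι ∈ Finset.Icc 1 t, Matrix.vecMulVec (φ ι) (φ ι)) :
    (((Finset.Icc 1 T).filter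
        (fun t => 1 ≤ dotProduct (φ t) ((Λ (t - 1))⁻¹.mulVec (φ t)))).card : ℝ)
      ≤ (3 * d / Real.log 2) * Real.log (1 + 1 / (lam * Real.log 2)) := by
  have : Nonempty (Fin d) := ⟨⟨0, hd⟩⟩
  obtain rfl : Λ = fun t => regularizedGram lam φ (Icc 1 t) := funext hΛ
  set S := (Finset.Icc 1 T).filter
    (fun t => 1 ≤ dotProduct (φ t) ((regularizedGram lam φ (Icc 1 (t - 1)))⁻¹.mulVec (φ t)))
    with hS
  have hd' : (0 : ℝ) < d := by exact_mod_cast hd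
  have hlog2 : 0 < log 2 := log_pos one_lt_two
  have hdet := pow_mul_two_pow_le_det_regularizedGram hlam _ (fun _ h => h) T (φ := φ)
  rw [← hS, Fintype.card_fin] at hdet
  have hpd := posDef_regularizedGram (φ := φ) (s := S) hlam
  have htrace : (regularizedGram lam φ S).trace ≤ lam * d + #S := by
    simpa using trace_regularizedGram_le (lam := lam) (φ := φ) (s := S) fun t ht => by
      simpa [dotProduct, sq] using hφ t (mem_of_mem_filter t ht)
  have hbound : d * log lam + #S * log 2 ≤ d * log (lam * (1 + #S / (d * lam))) := by
    calc d * log lam + #S * log 2 = log (lam ^ d * 2 ^ #S) := by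
          rw [log_mul (by positivity) (by positivity), log_pow, log_pow]
      _ ≤ log (regularizedGram lam φ S).det := log_le_log (by positivity) hdet
      _ ≤ d * log ((regularizedGram lam φ S).trace / d) := by simpa using hpd.log_det_le
      _ ≤ d * log (lam * (1 + #S / (d * lam))) := by
          gcongr
          · exact div_pos hpd.trace_pos hd'
          · rw [div_le_iff₀ hd']
            refine htrace.trans_eq ?_
            field_simp
  rw [log_mul hlam.ne' (by positivity), mul_add] at hbound
  have hy := le_three_mul_log_of_le_log (a := 1 / (lam * log 2)) (y := #S * log 2 / d)
    (by positivity) (by positivity) (by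
      rw [div_le_iff₀ hd', show 1 / (lam * log 2) * (#S * log 2 / d) = #S / (d * lam) by
        field_simp]
      linarith)
  rw [div_le_iff₀ hd'] at hy
  rw [div_mul_eq_mul_div, le_div_iff₀ hlog2]
  linarith
end
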